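/- The system S(λ; w_1,w_2,w_3,w_4) contains a state that has no merge at any vertex if and only if w_c = w_d. -/

import Mathlib

/-- A spin: `Sum.inl a` is the color `c_{a+1}`, `Sum.inr b` is the dolor `d_{b+1}`
(so indices are 0-based). -/
abbrev Spin (r : ℕ) := Fin r ⊕ Fin r

/-- The `k`-th boson (0-indexed) in the monochrome ordering:
`(c_a, d_b) < (c_{a'}, d_{b'})` iff `b > b'`, or `b = b'` and `a < a'`.
A boson is recorded as the pair (color index, dolor index), 0-based. -/
def bosonOfIdx {r : ℕ} (k : Fin (r * r)) : Fin r × Fin r :=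
  have hr : 0 < r := by
    rcases Nat.eq_zero_or_pos r with h | h
    · exact absurd k.2 (by simp [h])
    · exact h
  (⟨k.val % r, Nat.mod_lt _ hr⟩,
   ⟨r - 1 - k.val / r, lt_of_le_of_lt (Nat.sub_le _ _) (Nat.sub_lt hr one_pos)⟩)

/-- One admissibility step at boson `ab = (a,b)`, from spin `x` to spin `y`,
where `m` is the multiplicity function on the top edge and `m'` on the bottom edge:
either a pass, a split, or a merge. -/
def StepOK {r : ℕ} (m m' : Fin r × Fin r → ℕ) (ab : Fin r × Fin r)
    (x y : Spin r) : Prop :=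
  (y = x ∧ m' ab = m ab) ∨
  (x = Sum.inr ab.2 ∧ y = Sum.inl ab.1 ∧ m ab = m' ab + 1) ∨
  (x = Sum.inl ab.1 ∧ y = Sum.inr ab.2 ∧ m' ab = m ab + 1)

/-- Admissibility of a vertex datum: left spin `l`, top multiplicities `m`,
right spin `rr`, bottom multiplicities `m'`. -/
def AdmissibleVertex {r : ℕ} (l : Spin r) (m : Fin r × Fin r → ℕ) (rr : Spin r)
    (m' : Fin r × Fin r → ℕ) : Prop :=
  ∃ x : Fin (r * r + 1) → Spin r, x 0 = l ∧ x (Fin.last _) = rr ∧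
    ∀ k : Fin (r * r), StepOK m m' (bosonOfIdx k) (x k.castSucc) (x k.succ)

/-- The coefficient ring `ℤ[t][z_1,…,z_r]`, with `t = X none` and `z_{i+1} = X (some i)`. -/
abbrev PolyR (r : ℕ) := MvPolynomial (Option (Fin r)) ℤ

/-- The variable `t`. -/
noncomputable def tP (r : ℕ) : PolyR r := MvPolynomial.X none

/-- The variable `z_{i+1}`. -/
noncomputable def zP {r : ℕ} (i : Fin r) : PolyR r := MvPolynomial.X (some i)

/-- Weight of a pass step at boson `ab`, where the horizontal spin is `x`,
`n` is the number of bosons on the (equal) vertical edges, and `zi` is the row parameter. -/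
noncomputable def passWeight {r : ℕ} (zi : PolyR r) (n : ℕ) (ab : Fin r × Fin r)
    (x : Spin r) : PolyR r :=
  match x with
  | Sum.inl e => if e = ab.1 then zi else if e < ab.1 then tP r ^ n else 1
  | Sum.inr e =>
      if e = ab.2 then 1
      else if ab.1.val = 0 then (if e < ab.2 then tP r ^ n * zi else zi)
      else (if e < ab.2 then tP r ^ n else 1)

/-- Weight of the step at boson `ab` with top multiplicity `m`, bottom multiplicity `m'`
and incoming horizontal spin `x`. -/
noncomputable def stepWeight {r : ℕ} (zi : PolyR r) (m m' : ℕ) (ab : Fin r × Fin r)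
    (x : Spin r) : PolyR r :=
  if m = m' + 1 then ∑ j ∈ Finset.range (min m m' + 1), tP r ^ j
  else if m' = m + 1 then (1 - tP r) * zi
  else passWeight zi (min m m') ab x

/-- The (necessarily unique) next horizontal spin at a boson `ab`. -/
def nextSpin {r : ℕ} (m m' : Fin r × Fin r → ℕ) (ab : Fin r × Fin r) (x : Spin r) : Spin r :=
  if m ab = m' ab + 1 then Sum.inl ab.1
  else if m' ab = m ab + 1 then Sum.inr ab.2
  else x

/-- The sequence of horizontal spins inside a vertex, starting from the left spin `l`.
For an admissible vertex this coincides with the unique admissibility sequence. -/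
def pathSpin {r : ℕ} (m m' : Fin r × Fin r → ℕ) (l : Spin r) : ℕ → Spin r
  | 0 => l
  | k + 1 =>
      if h : k < r * r then nextSpin m m' (bosonOfIdx ⟨k, h⟩) (pathSpin m m' l k)
      else pathSpin m m' l k

/-- Boltzmann weight of an admissible vertex with row parameter `zi`, left spin `l`,
top multiplicities `m` and bottom multiplicities `m'`. -/
noncomputable def vertexWeight {r : ℕ} (zi : PolyR r) (l : Spin r)
    (m m' : Fin r × Fin r → ℕ) : PolyR r :=
  ∏ k : Fin (r * r),
    stepWeight zi (m (bosonOfIdx k)) (m' (bosonOfIdx k)) (bosonOfIdx k)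
      (pathSpin m m' l k.val)

open Classical in
/-- `W(l, m, rr, m')`: the weight of the vertex datum if admissible, and `0` otherwise. -/
noncomputable def Wvert {r : ℕ} (zi : PolyR r) (l : Spin r) (m : Fin r × Fin r → ℕ)
    (rr : Spin r) (m' : Fin r × Fin r → ℕ) : PolyR r :=
  if AdmissibleVertex l m rr m' then vertexWeight zi l m m' else 0

/-- A filling of the `r × N` grid: `m i j` are the boson multiplicities on the vertical
edge of column `j` between rows `i` and `i+1` (row `0` is the top boundary),
and `h i j` is the horizontal spin of row `i+1` immediately to the right of column `j`
(`j = N` is the left boundary, `j = 0` the right boundary). -/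
structure Filling (r N : ℕ) where
  m : Fin (r + 1) → Fin N → Fin r × Fin r → ℕ
  h : Fin r → Fin (N + 1) → Spin r

/-- A state: every vertex is admissible. -/
def Filling.IsState {r N : ℕ} (f : Filling r N) : Prop :=
  ∀ (i : Fin r) (j : Fin N),
    AdmissibleVertex (f.h i j.succ) (f.m i.castSucc j) (f.h i j.castSucc) (f.m i.succ j)

/-- Membership in the system `S(λ; w_1, w_2, w_3, w_4)`. -/
def InSystem {r N : ℕ} (lam : Fin r → ℕ) (w1 w2 w3 w4 : Equiv.Perm (Fin r))
    (f : Filling r N) : Prop :=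
  f.IsState ∧
  (∀ (j : Fin N) (a b : Fin r),
      f.m 0 j (a, b) =
        (Finset.univ.filter fun i : Fin r =>
            lam i = j.val ∧ w3⁻¹ i = a ∧ w4⁻¹ (Fin.rev i) = b).card) ∧
  (∀ (j : Fin N) (ab : Fin r × Fin r), f.m (Fin.last r) j ab = 0) ∧
  (∀ i : Fin r, f.h i 0 = Sum.inl (w1⁻¹ i)) ∧
  (∀ i : Fin r, f.h i (Fin.last N) = Sum.inr (w2⁻¹ i))

/-- The Boltzmann weight of a state: the product of the weights of its vertices. -/
noncomputable def stateWeight {r N : ℕ} (f : Filling r N) : PolyR r :=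
  ∏ i : Fin r, ∏ j : Fin N,
    vertexWeight (zP i) (f.h i j.succ) (f.m i.castSucc j) (f.m i.succ j)

open Classical in
/-- The partition function `Z(λ; w_1, w_2, w_3, w_4)`: the sum of the weights of the
states of the system (a finite sum, expressed via `finsum`). -/
noncomputable def partitionZ (r N : ℕ) (lam : Fin r → ℕ)
    (w1 w2 w3 w4 : Equiv.Perm (Fin r)) : PolyR r :=
  finsum fun f : Filling r N =>
    if InSystem lam w1 w2 w3 w4 f then stateWeight f else 0

/-- The state `f` has a merge at vertex `(i+1, j)`. -/
def HasMergeAt {r N : ℕ} (f : Filling r N) (i : Fin r) (j : Fin N) : Prop :=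
  ∃ ab : Fin r × Fin r, f.m i.castSucc j ab < f.m i.succ j ab

/-- `ℓ(w)`: the number of inversions of a permutation. -/
def invCount {r : ℕ} (w : Equiv.Perm (Fin r)) : ℕ :=
  (Finset.univ.filter fun p : Fin r × Fin r => p.1 < p.2 ∧ w p.2 < w p.1).card

/-- A transposition in `S_r`. -/
def IsTransposition {r : ℕ} (t : Equiv.Perm (Fin r)) : Prop :=
  ∃ a b : Fin r, a ≠ b ∧ t = Equiv.swap a b

/-- Bruhat order on `S_r`. -/
def bruhatLE {r : ℕ} (u v : Equiv.Perm (Fin r)) : Prop :=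
  Relation.ReflTransGen
    (fun x y => ∃ t, IsTransposition t ∧ y = x * t ∧ invCount x < invCount y) u v


theorem bosonOfIdx_inj {r : ℕ} {k l : Fin (r * r)} (h : bosonOfIdx k = bosonOfIdx l) : k = l := by
  simp only [bosonOfIdx, Prod.mk.injEq, Fin.mk.injEq] at h
  obtain ⟨h1, h2⟩ := h
  have hk : k.val / r < r := Nat.div_lt_of_lt_mul k.2
  have hl : l.val / r < r := Nat.div_lt_of_lt_mul l.2
  have h3 : k.val / r = l.val / r := by omega
  apply Fin.ext
  rw [← Nat.div_add_mod k.val r, ← Nat.div_add_mod l.val r, h1, h3]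

theorem bosonOfIdx_surj {r : ℕ} (ab : Fin r × Fin r) : ∃ k : Fin (r * r), bosonOfIdx k = ab := by
  have hinj : Function.Injective (bosonOfIdx (r := r)) := fun _ _ h => bosonOfIdx_inj h
  have hb := (Fintype.bijective_iff_injective_and_card (bosonOfIdx (r := r))).2 ⟨hinj, by simp⟩
  exact hb.2 ab

theorem vertex_noMerge {r : ℕ} {l rr : Spin r} {m m' : Fin r × Fin r → ℕ}
    (hv : AdmissibleVertex l m rr m') (hm : ∀ ab, m' ab ≤ m ab) :
    rr = l ∨ ∃ a b, l = Sum.inr b ∧ rr = Sum.inl a ∧ 0 < m (a, b) := by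
  obtain ⟨x, h0, h1, hx⟩ := hv
  have key : ∀ k : Fin (r * r + 1),
      x k = l ∨ ∃ a b, l = Sum.inr b ∧ x k = Sum.inl a ∧ 0 < m (a, b) := by
    intro k
    induction k using Fin.induction with
    | zero => exact Or.inl h0
    | succ k ih =>
      rcases hx k with ⟨h2, _⟩ | ⟨h2, h3, h4⟩ | ⟨_, _, h4⟩
      · rw [h2]; exact ih
      · rcases ih with ih | ⟨a, b, _, ih, _⟩
        · refine Or.inr ⟨(bosonOfIdx k).1, (bosonOfIdx k).2, ?_, h3, ?_⟩
          · rw [← ih, h2]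
          · simp only [Prod.mk.eta]; omega
        · rw [h2] at ih; cases ih
      · have := hm (bosonOfIdx k); omega
  have := key (Fin.last _)
  rwa [h1] at this

theorem vertex_const {r : ℕ} (l : Spin r) {m m' : Fin r × Fin r → ℕ} (h : m' = m) :
    AdmissibleVertex l m l m' :=
  ⟨fun _ => l, rfl, rfl, fun _ => Or.inl ⟨rfl, by rw [h]⟩⟩

theorem vertex_split {r : ℕ} (a b : Fin r) {m m' : Fin r × Fin r → ℕ}
    (h : ∀ ab, m ab = m' ab + if ab = (a, b) then 1 else 0) :
    AdmissibleVertex (Sum.inr b) m (Sum.inl a) m' := by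
  obtain ⟨k0, hk0⟩ := bosonOfIdx_surj (a, b)
  refine ⟨fun k => if k.val ≤ k0.val then Sum.inr b else Sum.inl a, by simp, ?_, ?_⟩
  · have := k0.2
    simp only [Fin.val_last]
    rw [if_neg (by omega)]
  · intro k
    by_cases hk : k = k0
    · subst hk
      refine Or.inr (Or.inl ?_)
      rw [h]
      simp [hk0]
    · have hne : bosonOfIdx k ≠ (a, b) := fun hh => hk (bosonOfIdx_inj (hh.trans hk0.symm))
      refine Or.inl ⟨?_, ?_⟩
      · have : k.val ≠ k0.val := fun hh => hk (Fin.ext hh)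
        have h5 : (k.succ.val ≤ k0.val) ↔ (k.castSucc.val ≤ k0.val) := by
          simp only [Fin.val_succ, Fin.val_castSucc]; omega
        simp only [h5]
      · rw [h, if_neg hne]; rfl

/-- the system contains a state with no merge at any vertex iff `w_c = w_d`. -/
theorem stmt7 (r N : ℕ) (hr : 1 ≤ r) (hN : 1 ≤ N)
    (lam : Fin r → ℕ)
    (hpart : ∀ i j : Fin r, i ≤ j → lam j ≤ lam i)
    (hlam1 : lam ⟨0, hr⟩ ≤ N - 1)
    (w1 w2 w3 w4 : Equiv.Perm (Fin r)) :
    (∃ f : Filling r N, InSystem lam w1 w2 w3 w4 f ∧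
        ∀ (i : Fin r) (j : Fin N), ¬HasMergeAt f i j) ↔
      w3 * w1⁻¹ = Fin.revPerm * w4 * w2⁻¹ := by
  constructor
  · rintro ⟨f, ⟨hst, htop, _, hright, hleft⟩, hno⟩
    have hle : ∀ (i : Fin r) (j : Fin N) ab, f.m i.succ j ab ≤ f.m i.castSucc j ab := by
      intro i j ab
      by_contra hc
      exact hno i j ⟨ab, not_le.1 hc⟩
    have hle0 : ∀ (i : Fin (r + 1)) (j : Fin N) ab, f.m i j ab ≤ f.m 0 j ab := by
      intro i j ab
      induction i using Fin.induction with
      | zero => exact le_rfl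
      | succ i ih => exact (hle i j ab).trans ih
    ext1 k
    have key : ∀ j : Fin (N + 1), f.h k j = Sum.inr (w2⁻¹ k) ∨
        ∃ a j', f.h k j = Sum.inl a ∧ 0 < f.m k.castSucc j' (a, w2⁻¹ k) := by
      intro j
      induction j using Fin.reverseInduction with
      | last => exact Or.inl (hleft k)
      | cast j ih =>
        rcases vertex_noMerge (hst k j) (hle k j) with h | ⟨a, b, h1, h2, h3⟩
        · rw [h]; exact ih
        · rcases ih with ih | ⟨a', j', ih, _⟩
          · rw [ih] at h1
            cases h1
            exact Or.inr ⟨a, j, h2, h3⟩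
          · rw [h1] at ih; cases ih
    rcases key 0 with h | ⟨a, j, h, hpos⟩
    · rw [hright] at h; cases h
    · rw [hright] at h
      cases h
      have h2 := lt_of_lt_of_le hpos (hle0 _ _ _)
      rw [htop, Finset.card_pos] at h2
      obtain ⟨i, hi⟩ := h2
      simp only [Finset.mem_filter, Finset.mem_univ, true_and] at hi
      obtain ⟨_, hi1, hi2⟩ := hi
      simp only [Equiv.Perm.mul_apply, Fin.revPerm_apply]
      rw [← hi1, ← hi2]
      simp
  · intro hw
    have hw' : ∀ k, w3 (w1⁻¹ k) = Fin.rev (w4 (w2⁻¹ k)) := fun k => by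
      have := congrArg (fun e : Equiv.Perm (Fin r) => e k) hw
      simpa using this
    have hlam : ∀ i, lam i < N := fun i => by
      have := hpart ⟨0, hr⟩ i (Nat.zero_le _)
      omega
    let f : Filling r N :=
      { m := fun i j ab => (Finset.univ.filter fun k : Fin r =>
            i.val ≤ k.val ∧ lam (w3 (w1⁻¹ k)) = j.val ∧ ab = (w1⁻¹ k, w2⁻¹ k)).card
        h := fun i j => if j.val ≤ lam (w3 (w1⁻¹ i)) then Sum.inl (w1⁻¹ i)
            else Sum.inr (w2⁻¹ i) }
    have fm : ∀ i j ab, f.m i j ab = (Finset.univ.filter fun k : Fin r =>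
        i.val ≤ k.val ∧ lam (w3 (w1⁻¹ k)) = j.val ∧ ab = (w1⁻¹ k, w2⁻¹ k)).card :=
      fun _ _ _ => rfl
    have hm : ∀ (i : Fin r) (j : Fin N) ab, f.m i.castSucc j ab = f.m i.succ j ab +
        if lam (w3 (w1⁻¹ i)) = j.val ∧ ab = (w1⁻¹ i, w2⁻¹ i) then 1 else 0 := by
      intro i j ab
      have hs : (Finset.univ.filter fun k : Fin r => i.castSucc.val ≤ k.val ∧
            lam (w3 (w1⁻¹ k)) = j.val ∧ ab = (w1⁻¹ k, w2⁻¹ k)) =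
          (Finset.univ.filter fun k : Fin r => i.succ.val ≤ k.val ∧
            lam (w3 (w1⁻¹ k)) = j.val ∧ ab = (w1⁻¹ k, w2⁻¹ k)) ∪
          (if lam (w3 (w1⁻¹ i)) = j.val ∧ ab = (w1⁻¹ i, w2⁻¹ i) then {i} else ∅) := by
        ext k
        simp only [Finset.mem_union, Finset.mem_filter, Finset.mem_univ, true_and,
          Fin.val_castSucc, Fin.val_succ]
        by_cases hk : k = i
        · subst hk
          split_ifs with h
          · simp only [h, le_refl, Finset.mem_singleton, and_self, or_true]
          · simp only [h, Finset.notMem_empty, and_false, or_false]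
        · have hk' : k.val ≠ i.val := fun hh => hk (Fin.ext hh)
          have h6 : i.val ≤ k.val ↔ i.val + 1 ≤ k.val := by omega
          rw [h6]
          split_ifs <;> simp [hk]
      rw [fm, fm, hs, Finset.card_union_of_disjoint]
      · split_ifs <;> simp
      · split_ifs <;> simp
    refine ⟨f, ⟨?_, ?_, ?_, ?_, ?_⟩, ?_⟩
    · intro i j
      rcases lt_trichotomy (lam (w3 (w1⁻¹ i))) j.val with h | h | h
      · have e1 : f.h i j.succ = Sum.inr (w2⁻¹ i) := if_neg (by simp only [Fin.val_succ, Fin.val_castSucc]; omega)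
        have e2 : f.h i j.castSucc = Sum.inr (w2⁻¹ i) := if_neg (by simp only [Fin.val_succ, Fin.val_castSucc]; omega)
        rw [e1, e2]
        refine vertex_const _ (funext fun ab => ?_)
        rw [hm, if_neg (by omega)]; rfl
      · have e1 : f.h i j.succ = Sum.inr (w2⁻¹ i) := if_neg (by simp only [Fin.val_succ, Fin.val_castSucc]; omega)
        have e2 : f.h i j.castSucc = Sum.inl (w1⁻¹ i) := if_pos (by simp only [Fin.val_succ, Fin.val_castSucc]; omega)
        rw [e1, e2]
        refine vertex_split _ _ fun ab => ?_
        rw [hm]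
        simp only [h, true_and]
      · have e1 : f.h i j.succ = Sum.inl (w1⁻¹ i) := if_pos (by simp only [Fin.val_succ, Fin.val_castSucc]; omega)
        have e2 : f.h i j.castSucc = Sum.inl (w1⁻¹ i) := if_pos (by simp only [Fin.val_succ, Fin.val_castSucc]; omega)
        rw [e1, e2]
        refine vertex_const _ (funext fun ab => ?_)
        rw [hm, if_neg (by omega)]; rfl
    · intro j a b
      rw [fm]
      refine Finset.card_bij (fun k _ => w3 (w1⁻¹ k)) ?_ ?_ ?_
      · intro k hk
        simp only [Finset.mem_filter, Finset.mem_univ, true_and, Prod.mk.injEq] at hk ⊢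
        obtain ⟨_, h1, h2, h3⟩ := hk
        refine ⟨h1, ?_, ?_⟩
        · rw [h2]; simp
        · rw [hw', h3]; simp
      · intro k _ l _ hkl
        exact w1⁻¹.injective (w3.injective hkl)
      · intro i hi
        simp only [Finset.mem_filter, Finset.mem_univ, true_and] at hi
        obtain ⟨h1, h2, h3⟩ := hi
        have h7 : w3 (w1⁻¹ (w1 (w3⁻¹ i))) = i := by simp
        refine ⟨w1 (w3⁻¹ i), ?_, h7⟩
        simp only [Finset.mem_filter, Finset.mem_univ, true_and, Prod.mk.injEq]
        refine ⟨Nat.zero_le _, ?_, ?_, ?_⟩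
        · rw [h7, h1]
        · rw [h2]; simp
        · have := hw' (w1 (w3⁻¹ i))
          rw [h7] at this
          rw [← h3, Equiv.Perm.inv_eq_iff_eq, ← Fin.rev_rev (w4 _), ← this]
    · intro j ab
      rw [fm]
      refine Finset.card_eq_zero.2 (Finset.filter_eq_empty_iff.2 fun k _ hk => ?_)
      have := hk.1
      simp only [Fin.val_last] at this
      omega
    · intro i
      exact if_pos (e := Sum.inr (w2⁻¹ i)) (c := (0 : Fin (N + 1)).val ≤ lam (w3 (w1⁻¹ i))) (Nat.zero_le _)
    · intro i
      exact if_neg (not_le.2 (hlam (w3 (w1⁻¹ i))))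
    · rintro i j ⟨ab, h⟩
      rw [hm] at h
      omega
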